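/- Fix c > 0 and n ≥ 1. Suppose that for every convex function V : ℝⁿ → ℝ whose Fenchel-Legendre transform V* is finite everywhere, the inequality H(η) + H(η*) ≤ −n·log(c·e²) + ∫ V* dν + ∫ V dν* holds, where η, η* are the probability measures proportional to e^{-V}, e^{-V*} and ν = (∇V)#η, ν* = (∇V*)#η*. Then for every proper convex lower semicontinuous f : ℝⁿ → ℝ ∪ {+∞} with ∫ e^{-f} dx > 0 and ∫ e^{-f*} dx > 0, one has ∫ e^{-f(x)} dx · ∫ e^{-f*(x)} dx ≥ cⁿ. -/

import Mathlib

open MeasureTheory Real Set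
open scoped ENNReal InnerProductSpace

noncomputable section

variable {E : Type*} [NormedAddCommGroup E] [InnerProductSpace ℝ E]

/-- `exp (-t)` for an extended-real `t`, with the convention that it is `0` at `⊤`
(proper functions never take the value `⊥`; we also set the value at `⊥` to `0`). -/
def expNeg (t : EReal) : ℝ := if t = ⊤ then 0 else if t = ⊥ then 0 else Real.exp (-t.toReal)

/-- Convexity for extended-real-valued functions. -/
def ConvexEReal (f : E → EReal) : Prop :=
  ∀ x y : E, ∀ a b : ℝ, 0 ≤ a → 0 ≤ b → a + b = 1 →
    f (a • x + b • y) ≤ (a : EReal) * f x + (b : EReal) * f y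

/-- The class `𝓕` of proper convex lower semicontinuous functions `E → ℝ ∪ {+∞}`. -/
def IsProperConvexLSC (f : E → EReal) : Prop :=
  ConvexEReal f ∧ LowerSemicontinuous f ∧ (∀ x, f x ≠ ⊥) ∧ (∃ x, f x ≠ ⊤)

/-- Fenchel-Legendre transform of an extended-real-valued function. -/
def fenchel (f : E → EReal) (y : E) : EReal := ⨆ x : E, (⟪x, y⟫_ℝ : EReal) - f x

/-- Fenchel-Legendre transform of a real-valued function. -/
def fenchelR (f : E → ℝ) (y : E) : EReal := ⨆ x : E, ((⟪x, y⟫_ℝ - f x : ℝ) : EReal)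

/-- positive part of an extended real, as `ℝ≥0∞`. -/
def ERealPos (t : EReal) : ℝ≥0∞ := if t = ⊤ then ⊤ else ENNReal.ofReal t.toReal

/-- Integral of an extended-real-valued function, with value in `EReal`. -/
def eintegral {α : Type*} [MeasurableSpace α] (μ : Measure α) (g : α → EReal) : EReal :=
  ((∫⁻ x, ERealPos (g x) ∂μ : ℝ≥0∞) : EReal) - ((∫⁻ x, ERealPos (-(g x)) ∂μ : ℝ≥0∞) : EReal)

variable [MeasurableSpace E]

/-- The maximal correlation transport cost `𝒯(μ₁, μ₂)`. -/
def mcCost (μ₁ μ₂ : Measure E) : EReal :=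
  ⨅ f : {f : E → EReal // IsProperConvexLSC f},
    eintegral μ₁ f.1 + eintegral μ₂ (fenchel f.1)

/-- The probability measure proportional to `e^{-W}` (with respect to Lebesgue measure). -/
def probOf {n : ℕ} (W : EuclideanSpace ℝ (Fin n) → ℝ) : Measure (EuclideanSpace ℝ (Fin n)) :=
  (∫⁻ x, ENNReal.ofReal (Real.exp (-(W x))))⁻¹ •
    volume.withDensity (fun x => ENNReal.ofReal (Real.exp (-(W x))))

/-- Relative entropy with respect to the Lebesgue measure. -/
def relEnt {n : ℕ} (μ : Measure (EuclideanSpace ℝ (Fin n))) : ℝ :=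
  ∫ x, Real.log ((μ.rnDeriv volume x).toReal) ∂μ

open Filter Topology Metric

section Convexity

variable {F : Type*} [NormedAddCommGroup F] [InnerProductSpace ℝ F]

lemma ConvexEReal.le_coe {f : F → EReal} (hf : ConvexEReal f) {x y : F} {p q a b : ℝ}
    (hx : f x ≤ p) (hy : f y ≤ q) (ha : 0 ≤ a) (hb : 0 ≤ b) (hab : a + b = 1) :
    f (a • x + b • y) ≤ ((a * p + b * q : ℝ) : EReal) := by
  refine (hf x y a b ha hb hab).trans ?_
  rw [EReal.coe_add, EReal.coe_mul, EReal.coe_mul]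
  exact add_le_add (mul_le_mul_of_nonneg_left hx (by exact_mod_cast ha))
    (mul_le_mul_of_nonneg_left hy (by exact_mod_cast hb))

lemma ConvexEReal.convex_ne_top {f : F → EReal} (hf : ConvexEReal f) (hbot : ∀ x, f x ≠ ⊥) :
    Convex ℝ {x | f x ≠ ⊤} := by
  intro x hx y hy a b ha hb hab
  have := hf.le_coe (EReal.coe_toReal hx (hbot x)).ge (EReal.coe_toReal hy (hbot y)).ge ha hb hab
  exact ne_top_of_le_ne_top (EReal.coe_ne_top _) this

lemma ConvexEReal.convexOn_toReal {f : F → EReal} (hf : ConvexEReal f) (hbot : ∀ x, f x ≠ ⊥) :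
    ConvexOn ℝ {x | f x ≠ ⊤} (fun x => (f x).toReal) := by
  refine ⟨hf.convex_ne_top hbot, fun x hx y hy a b ha hb hab => ?_⟩
  have := hf.le_coe (EReal.coe_toReal hx (hbot x)).ge (EReal.coe_toReal hy (hbot y)).ge ha hb hab
  have h2 := EReal.toReal_le_toReal this (hbot _) (EReal.coe_ne_top _)
  rwa [EReal.toReal_coe] at h2

lemma ConvexEReal.convex_le {f : F → EReal} (hf : ConvexEReal f) (m : ℝ) :
    Convex ℝ {x | f x ≤ m} := by
  intro x hx y hy a b ha hb hab
  have := hf.le_coe hx hy ha hb hab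
  rwa [← add_mul, hab, one_mul] at this

lemma expNeg_anti {s t : EReal} (hs : s ≠ ⊥) (hst : s ≤ t) : expNeg t ≤ expNeg s := by
  unfold expNeg
  induction t with
  | bot => exact absurd (le_bot_iff.1 hst) hs
  | top => simp only [if_true]; split_ifs <;> positivity
  | coe t =>
    induction s with
    | bot => exact absurd rfl hs
    | top => simp at hst
    | coe s => simpa using hst

lemma measurable_expNeg : Measurable expNeg := by
  unfold expNeg
  refine Measurable.ite (measurableSet_singleton _) measurable_const ?_
  refine Measurable.ite (measurableSet_singleton _) measurable_const ?_
  exact measurable_ereal_toReal.neg.exp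

lemma coe_inner_sub_le_fenchel (f : F → EReal) (x y : F) :
    ((⟪x, y⟫_ℝ : ℝ) : EReal) - f x ≤ fenchel f y :=
  le_iSup (fun x : F => (⟪x, y⟫_ℝ : EReal) - f x) x

lemma fenchel_ne_bot {f : F → EReal} (hbot : ∀ x, f x ≠ ⊥) (hf : ∃ x, f x ≠ ⊤) (y : F) :
    fenchel f y ≠ ⊥ := by
  obtain ⟨x, hx⟩ := hf
  refine ne_bot_of_le_ne_bot ?_ (coe_inner_sub_le_fenchel f x y)
  rw [← EReal.coe_toReal hx (hbot x), ← EReal.coe_sub]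
  exact EReal.coe_ne_bot _

lemma measurable_fenchel [MeasurableSpace F] [BorelSpace F] {f : F → EReal}
    (hbot : ∀ x, f x ≠ ⊥) : Measurable (fenchel f) := by
  refine LowerSemicontinuous.measurable ?_
  refine lowerSemicontinuous_iSup fun x => ?_
  by_cases hx : f x = ⊤
  · simp only [hx]
    have : ∀ y : F, (⟪x, y⟫_ℝ : EReal) - ⊤ = ⊥ := fun y => EReal.sub_top _
    simp only [this]
    exact lowerSemicontinuous_const
  · refine Continuous.lowerSemicontinuous ?_
    rw [← EReal.coe_toReal hx (hbot x)]
    simp only [← EReal.coe_sub]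
    exact continuous_coe_real_ereal.comp (by fun_prop)

variable [FiniteDimensional ℝ F] [MeasurableSpace F] [BorelSpace F]
  {μ : Measure F} [μ.IsAddHaarMeasure]

lemma lintegral_eq_zero_of_le_translate {g : F → ℝ≥0∞} (hg : Measurable g) {u : F} (hu : u ≠ 0)
    (h : ∀ t : ℝ, 0 ≤ t → ∀ x, g x ≤ g (x + t • u)) (hfin : ∫⁻ x, g x ∂μ ≠ ⊤) :
    ∫⁻ x, g x ∂μ = 0 := by
  have hu2 : 0 < ⟪u, u⟫_ℝ := real_inner_self_pos.2 hu
  set A : ℝ → Set F := fun s => {x | s ≤ ⟪x, u⟫_ℝ} with hA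
  have hAm : ∀ s, MeasurableSet (A s) := fun s =>
    measurableSet_le measurable_const (by fun_prop)
  have key : ∀ k : ℕ, (A k).indicator g =ᵐ[μ] (A (-k)).indicator g := by
    intro k
    refine ae_eq_of_ae_le_of_lintegral_le ?_ ?_ ((hg.indicator (hAm _)).aemeasurable) ?_
    · refine ae_of_all _ fun x => indicator_le_indicator_of_subset ?_ (fun _ => zero_le) x
      intro x hx
      have : (0 : ℝ) ≤ k := Nat.cast_nonneg k
      simp only [hA, mem_ofPred_eq] at hx ⊢
      linarith
    · refine ne_top_of_le_ne_top hfin (lintegral_mono fun x => indicator_le_self _ _ x)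
    · set t : ℝ := 2 * k / ⟪u, u⟫_ℝ
      have ht : 0 ≤ t := by positivity
      rw [← lintegral_add_right_eq_self (fun x => (A (k : ℝ)).indicator g x) (t • u)]
      refine lintegral_mono fun x => ?_
      by_cases hx : x ∈ A (-k)
      · have hx' : x + t • u ∈ A k := by
          simp only [hA, mem_ofPred_eq] at hx ⊢
          rw [inner_add_left, inner_smul_left]
          simp only [conj_trivial, t]
          rw [div_mul_cancel₀ _ hu2.ne']
          linarith
        simp only [indicator_of_mem hx, indicator_of_mem hx']
        exact h t ht x
      · simp [indicator_of_notMem hx]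
  rw [lintegral_eq_zero_iff hg]
  filter_upwards [ae_all_iff.2 key] with x hx
  obtain ⟨k, hk⟩ := exists_nat_gt |⟪x, u⟫_ℝ|
  have h1 : x ∉ A k := by
    simp only [hA, mem_ofPred_eq, not_le]
    exact (le_abs_self _).trans_lt hk
  have h2 : x ∈ A (-k) := by
    simp only [hA, mem_ofPred_eq]
    linarith [neg_abs_le ⟪x, u⟫_ℝ]
  have := hx k
  rw [indicator_of_notMem h1, indicator_of_mem h2] at this
  exact this.symm

lemma zero_mem_interior_of_lintegral_fenchel {f : F → EReal} (hf : IsProperConvexLSC f)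
    (hpos : 0 < ∫⁻ x, ENNReal.ofReal (expNeg (f x)) ∂μ)
    (hpos' : 0 < ∫⁻ y, ENNReal.ofReal (expNeg (fenchel f y)) ∂μ)
    (hfin : ∫⁻ y, ENNReal.ofReal (expNeg (fenchel f y)) ∂μ ≠ ⊤) :
    (0 : F) ∈ interior {x | f x ≠ ⊤} := by
  obtain ⟨hconv, -, hbot, hproper⟩ := hf
  by_contra h0
  have hD := hconv.convex_ne_top hbot
  have hne : (interior {x | f x ≠ ⊤}).Nonempty := by
    rw [nonempty_iff_ne_empty]
    intro hempty
    have hnull : μ {x | f x ≠ ⊤} = 0 := by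
      refine measure_mono_null ?_ (hD.addHaar_frontier μ)
      rw [frontier, hempty, sdiff_empty]
      exact subset_closure
    refine hpos.ne' ?_
    refine lintegral_eq_zero_of_ae_eq_zero ?_
    filter_upwards [measure_eq_zero_iff_ae_notMem.1 hnull] with x hx
    have : f x = ⊤ := by simpa using hx
    simp [this, expNeg]
  obtain ⟨φ, s, hφ, hφs, hs0⟩ := geometric_hahn_banach_of_nonempty_interior hD
    (convex_singleton (0 : F)) (disjoint_singleton_right.2 h0) hne (singleton_nonempty _)
  have hs : s ≤ 0 := by simpa using hs0 0 rfl
  set u := (InnerProductSpace.toDual ℝ F).symm φ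
  have hu : u ≠ 0 := by simpa [u] using hφ
  have hφu : ∀ x, φ x = ⟪x, u⟫_ℝ := fun x => by
    rw [real_inner_comm]; exact (InnerProductSpace.toDual_symm_apply).symm
  refine hpos'.ne' (lintegral_eq_zero_of_le_translate
    (measurable_expNeg.comp (measurable_fenchel hbot)).ennreal_ofReal hu ?_ hfin)
  intro t ht y
  refine ENNReal.ofReal_le_ofReal (expNeg_anti (fenchel_ne_bot hbot hproper _) ?_)
  refine iSup_le fun x => ?_
  by_cases hx : f x = ⊤
  · rw [hx, EReal.sub_top]; exact bot_le
  refine le_trans ?_ (coe_inner_sub_le_fenchel f x y)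
  refine EReal.sub_le_sub ?_ le_rfl
  rw [EReal.coe_le_coe_iff, inner_add_right, inner_smul_right]
  have h1 : ⟪x, u⟫_ℝ ≤ 0 := by rw [← hφu]; exact (hφs x hx).trans hs
  nlinarith [mul_nonneg ht (neg_nonneg.2 h1)]

omit [MeasurableSpace F] [BorelSpace F] in
lemma ConvexEReal.exists_le_on_ball {f : F → EReal} (hconv : ConvexEReal f)
    (hbot : ∀ x, f x ≠ ⊥) (h0 : (0 : F) ∈ interior {x | f x ≠ ⊤}) :
    ∃ r M : ℝ, 0 < r ∧ ∀ x, ‖x‖ ≤ r → f x ≤ M := by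
  have hc := (hconv.convexOn_toReal hbot).continuousOn_interior
  have hc0 := hc.continuousAt (isOpen_interior.mem_nhds h0)
  have h1 : ∀ᶠ x in 𝓝 (0 : F), (f x).toReal < (f 0).toReal + 1 :=
    hc0.eventually_lt continuousAt_const (lt_add_one _)
  have h2 : ∀ᶠ x in 𝓝 (0 : F), f x ≠ ⊤ := mem_interior_iff_mem_nhds.1 h0
  obtain ⟨r, hr, h⟩ := Metric.nhds_basis_closedBall.eventually_iff.1 (h1.and h2)
  refine ⟨r, (f 0).toReal + 1, hr, fun x hx => ?_⟩
  obtain ⟨h3, h4⟩ := h (by simpa using hx)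
  rw [← EReal.coe_toReal h4 (hbot x)]
  exact_mod_cast h3.le

lemma IsProperConvexLSC.exists_linear_growth {f : F → EReal} (hf : IsProperConvexLSC f)
    (h0 : (0 : F) ∈ interior {x | f x ≠ ⊤})
    (hfin : ∫⁻ x, ENNReal.ofReal (expNeg (f x)) ∂μ ≠ ⊤) :
    ∃ a b : ℝ, 0 < a ∧ ∀ x, ((a * ‖x‖ - b : ℝ) : EReal) ≤ f x := by
  obtain ⟨hconv, hlsc, hbot, -⟩ := hf
  obtain ⟨r, M, hr, hM⟩ := hconv.exists_le_on_ball hbot h0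
  set K : Set F := {x | f x ≤ ((M + 1 : ℝ) : EReal)} with hK
  have hKc : IsClosed K := hlsc.isClosed_preimage _
  have hKb : Bornology.IsBounded K := by
    by_contra hunb
    obtain ⟨u, hu, huK⟩ := not_bounded_iff_exists_ne_zero_mem_asymptoticCone.1 hunb
    have hray : ∀ t : ℝ, 0 ≤ t → ∀ x ∈ K, x + t • u ∈ K := fun t ht x hx => by
      have := (hconv.convex_le (M + 1)).smul_vadd_mem_of_isClosed_of_mem_asymptoticCone hKc ht
        huK hx
      rwa [vadd_eq_add, add_comm (t • u)] at this
    have hKfin : ∫⁻ x, K.indicator (fun _ => ENNReal.ofReal (Real.exp (-(M + 1)))) x ∂μ ≠ ⊤ := by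
      refine ne_top_of_le_ne_top hfin (lintegral_mono fun x => ?_)
      refine indicator_apply_le' (fun hx => ?_) (fun _ => zero_le)
      refine ENNReal.ofReal_le_ofReal ?_
      refine le_trans (le_of_eq ?_) (expNeg_anti (hbot x) hx)
      rw [expNeg, if_neg (EReal.coe_ne_top _), if_neg (EReal.coe_ne_bot _), EReal.toReal_coe]
    have hz := lintegral_eq_zero_of_le_translate (μ := μ)
      (g := K.indicator (fun _ => ENNReal.ofReal (Real.exp (-(M + 1)))))
      (measurable_const.indicator hKc.measurableSet) hu (fun t ht x => ?_) hKfin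
    · rw [lintegral_indicator_const hKc.measurableSet, mul_eq_zero] at hz
      rcases hz with hz | hz
      · simp only [ENNReal.ofReal_eq_zero] at hz
        exact absurd hz (not_le.2 (Real.exp_pos _))
      · refine (measure_closedBall_pos μ (0 : F) hr).ne' (measure_mono_null ?_ hz)
        intro x hx
        refine (hM x (by simpa using hx)).trans ?_
        exact_mod_cast (lt_add_one M).le
    · by_cases hx : x ∈ K
      · rw [indicator_of_mem hx, indicator_of_mem (hray t ht x hx)]
      · simp [indicator_of_notMem hx]
  obtain ⟨R, hR0, hR⟩ := hKb.exists_pos_norm_le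
  obtain ⟨R', hR'⟩ : ∃ R', R' = R + 1 := ⟨_, rfl⟩
  have hR'0 : 0 < R' := by linarith
  obtain ⟨z, -, hz⟩ := (hlsc.lowerSemicontinuousOn _).exists_isMinOn
    (⟨0, by simp [hR'0.le]⟩ : (closedBall (0 : F) R').Nonempty) (isCompact_closedBall _ _)
  obtain ⟨m, hm⟩ : ∃ m : ℝ, (m : EReal) ≤ f z := by
    by_cases h : f z = ⊤
    · exact ⟨0, by simp [h]⟩
    · exact ⟨(f z).toReal, (EReal.coe_toReal h (hbot z)).le⟩
  refine ⟨1 / R', max (-M) (1 - m), by positivity, fun x => ?_⟩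
  by_cases hx : ‖x‖ ≤ R'
  · refine le_trans ?_ (hm.trans (hz (by simpa using hx)))
    rw [EReal.coe_le_coe_iff]
    have : 1 / R' * ‖x‖ ≤ 1 := by rw [one_div_mul_eq_div]; exact (div_le_one hR'0).2 hx
    linarith [le_max_right (-M) (1 - m)]
  · by_cases htop : f x = ⊤
    · simp [htop]
    push Not at hx
    have hx0 : 0 < ‖x‖ := hR'0.trans hx
    rw [← EReal.coe_toReal htop (hbot x), EReal.coe_le_coe_iff]
    set l := R' / ‖x‖
    have hl0 : 0 < l := by positivity
    have hl1 : l < 1 := (div_lt_one hx0).2 hx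
    have h1 := hconv.le_coe (EReal.coe_toReal htop (hbot x)).ge (hM 0 (by simpa using hr.le))
      hl0.le (sub_nonneg.2 hl1.le) (by ring)
    have h2 : ¬ f (l • x + (1 - l) • (0 : F)) ≤ ((M + 1 : ℝ) : EReal) := fun hmem => by
      have := hR _ hmem
      rw [smul_zero, add_zero, norm_smul, Real.norm_of_nonneg hl0.le,
        div_mul_cancel₀ _ hx0.ne'] at this
      linarith
    have h3 := (not_le.1 h2).trans_le h1
    rw [EReal.coe_lt_coe_iff] at h3
    have h4 : 1 / l < (f x).toReal - M := by
      rw [div_lt_iff₀ hl0]; linarith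
    have h5 : 1 / R' * ‖x‖ = 1 / l := by simp only [l]; field_simp
    rw [h5]
    linarith [le_max_left (-M) (1 - m)]

end Convexity

section Moment

variable {F : Type*} [NormedAddCommGroup F] [InnerProductSpace ℝ F]

lemma ConvexOn.add_inner_gradient_le [CompleteSpace F] {W : F → ℝ} (hW : ConvexOn ℝ univ W)
    {x : F} (hx : DifferentiableAt ℝ W x) (z : F) :
    W x + ⟪z - x, gradient W x⟫_ℝ ≤ W z := by
  have h1 : ConvexOn ℝ univ (W ∘ AffineMap.lineMap (k := ℝ) x z) := by
    simpa using hW.comp_affineMap (AffineMap.lineMap (k := ℝ) x z)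
  have h2 : HasDerivAt (W ∘ AffineMap.lineMap (k := ℝ) x z) (fderiv ℝ W x (z - x)) 0 := by
    refine HasFDerivAt.comp_hasDerivAt 0 ?_ AffineMap.hasDerivAt_lineMap
    simpa using hx.hasFDerivAt
  have h3 := h1.le_slope_of_hasDerivAt (mem_univ 0) (mem_univ 1) one_pos h2
  rw [slope_def_field] at h3
  rw [real_inner_comm, inner_gradient_left]
  simp at h3
  rw [map_sub]
  linarith

variable [FiniteDimensional ℝ F] [MeasurableSpace F] [BorelSpace F]
  {μ : Measure F} [μ.IsAddHaarMeasure]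

lemma integrable_exp_neg_mul_norm {a : ℝ} (ha : 0 < a) :
    Integrable (fun x : F => Real.exp (-(a * ‖x‖))) μ := by
  set m : ℕ := Module.finrank ℝ F + 1 with hm
  have hm0 : (0 : ℝ) < m := by positivity
  have hmr : (Module.finrank ℝ F : ℝ) < (m : ℝ) := by rw [hm]; push_cast; linarith
  set d : ℝ := min 1 (a / m)
  have hd : 0 < d := lt_min one_pos (by positivity)
  refine ((integrable_one_add_norm (μ := μ) hmr).const_mul ((d ^ m)⁻¹)).mono'
    (by fun_prop) (ae_of_all _ fun x => ?_)
  rw [Real.norm_of_nonneg (Real.exp_pos _).le, Real.exp_neg, Real.rpow_neg (by positivity),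
    Real.rpow_natCast, ← mul_inv, ← mul_pow]
  refine inv_anti₀ (by positivity) ?_
  have h1 : d * (1 + ‖x‖) ≤ Real.exp (a / m * ‖x‖) := by
    refine le_trans ?_ (Real.add_one_le_exp _)
    have := mul_le_mul_of_nonneg_right (min_le_right 1 (a / m)) (norm_nonneg x)
    have := min_le_left 1 (a / m)
    simp only [d]
    linarith
  calc (d * (1 + ‖x‖)) ^ m ≤ Real.exp (a / m * ‖x‖) ^ m := pow_le_pow_left₀ (by positivity) h1 m
    _ = Real.exp (a * ‖x‖) := by
      rw [← Real.exp_nat_mul]; congr 1; field_simp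

lemma integrable_exp_neg_of_growth {W : F → ℝ} (hWc : Continuous W) {a b : ℝ} (ha : 0 < a)
    (hgrow : ∀ x, a * ‖x‖ - b ≤ W x) : Integrable (fun x => Real.exp (-W x)) μ := by
  refine ((integrable_exp_neg_mul_norm (μ := μ) ha).const_mul (Real.exp b)).mono'
    (by fun_prop) (ae_of_all _ fun x => ?_)
  rw [Real.norm_of_nonneg (Real.exp_pos _).le, ← Real.exp_add, Real.exp_le_exp]
  linarith [hgrow x]

lemma integrable_mul_exp_neg_of_growth {W : F → ℝ} (hWc : Continuous W) {a b : ℝ} (ha : 0 < a)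
    (hgrow : ∀ x, a * ‖x‖ - b ≤ W x) : Integrable (fun x => W x * Real.exp (-W x)) μ := by
  have h1 : Integrable (fun x => Real.exp (-(W x / 2))) μ :=
    integrable_exp_neg_of_growth (a := a / 2) (b := b / 2) (by fun_prop) (by positivity)
      (fun x => by linarith [hgrow x])
  refine (h1.const_mul (2 + |b| * Real.exp (|b| / 2))).mono'
    (by fun_prop) (ae_of_all _ fun x => ?_)
  have hb : -|b| ≤ W x := by
    have := hgrow x
    have : 0 ≤ a * ‖x‖ := by positivity
    linarith [le_abs_self b]
  have hsplit : Real.exp (-W x) = Real.exp (-(W x / 2)) * Real.exp (-(W x / 2)) := by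
    rw [← Real.exp_add]; congr 1; ring
  rw [norm_mul, Real.norm_of_nonneg (Real.exp_pos _).le, hsplit, ← mul_assoc, Real.norm_eq_abs]
  refine mul_le_mul_of_nonneg_right ?_ (Real.exp_pos _).le
  have hpos := Real.exp_pos (|b| / 2)
  rcases le_total 0 (W x) with h | h
  · rw [abs_of_nonneg h]
    have h2 : W x * Real.exp (-(W x / 2)) ≤ 2 := by
      rw [Real.exp_neg, ← div_eq_mul_inv, div_le_iff₀ (Real.exp_pos _)]
      linarith [Real.add_one_le_exp (W x / 2)]
    have : 0 ≤ |b| * Real.exp (|b| / 2) := by positivity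
    linarith
  · have h2 : |W x| * Real.exp (-(W x / 2)) ≤ |b| * Real.exp (|b| / 2) := by
      rw [abs_of_nonpos h]
      refine mul_le_mul (by linarith) (Real.exp_le_exp.2 (by linarith)) (Real.exp_pos _).le
        (abs_nonneg _)
    linarith

lemma ConvexOn.ae_differentiableAt {W : F → ℝ} (hW : ConvexOn ℝ univ W) :
    ∀ᵐ x ∂μ, DifferentiableAt ℝ W x := by
  have hloc := hW.locallyLipschitz
  choose K t ht hK using hloc
  obtain ⟨s, hs, hcover⟩ := TopologicalSpace.countable_cover_nhds
    (fun x => interior_mem_nhds.2 (ht x))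
  have h : ∀ᵐ x ∂μ, ∀ y ∈ s, x ∈ t y → DifferentiableWithinAt ℝ W (t y) x :=
    (ae_ball_iff hs).2 fun y _ => (hK y).ae_differentiableWithinAt_of_mem
  filter_upwards [h] with x hx
  obtain ⟨y, hy, hxy⟩ := mem_iUnion₂.1 (hcover.symm ▸ mem_univ x)
  exact (hx y hy (interior_subset hxy)).differentiableAt (mem_interior_iff_mem_nhds.1 hxy)

lemma ConvexOn.integral_inner_gradient_mul_exp_neg_le {W : F → ℝ} (hW : ConvexOn ℝ univ W)
    {a b : ℝ} (ha : 0 < a) (hgrow : ∀ x, a * ‖x‖ - b ≤ W x) :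
    Integrable (fun x => ⟪x, gradient W x⟫_ℝ * Real.exp (-W x)) μ ∧
      ∫ x, ⟪x, gradient W x⟫_ℝ * Real.exp (-W x) ∂μ ≤
        Module.finrank ℝ F * ∫ x, Real.exp (-W x) ∂μ := by
  have hWc : Continuous W := hW.locallyLipschitz.continuous
  have hexp := integrable_exp_neg_of_growth (μ := μ) hWc ha hgrow
  set d := Module.finrank ℝ F with hd
  set z := ∫ x, Real.exp (-W x) ∂μ with hz
  have hz0 : 0 ≤ z := integral_nonneg fun x => (Real.exp_pos _).le
  have hgradm : Measurable (gradient W) :=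
    (InnerProductSpace.toDual ℝ F).symm.continuous.measurable.comp (measurable_fderiv ℝ W)
  have hWb : ∀ x, -b ≤ W x := fun x => by
    have : 0 ≤ a * ‖x‖ := by positivity
    linarith [hgrow x]
  set M := b + W 0
  have hM : 0 ≤ M := by linarith [hWb 0]
  set C := Real.exp M
  have hCM : M ≤ C := by linarith [Real.add_one_le_exp M]
  set φ : F → ℝ := fun x => ⟪x, gradient W x⟫_ℝ * Real.exp (-W x)
  have hφm : Measurable φ := by fun_prop
  have hφ0 : ∀ x, 0 ≤ φ x + C * Real.exp (-W x) := fun x => by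
    simp only [φ]
    rw [← add_mul]
    refine mul_nonneg ?_ (Real.exp_pos _).le
    by_cases hx : DifferentiableAt ℝ W x
    · have := hW.add_inner_gradient_le hx 0
      rw [zero_sub, inner_neg_left] at this
      linarith [hWb x]
    · rw [gradient_eq_zero_of_not_differentiableAt hx, inner_zero_right]
      linarith
  set t : ℕ → ℝ := fun k => 1 + 1 / ((k : ℝ) + 1)
  have ht : ∀ k, 1 < t k := fun k => by simp only [t]; have : 0 < 1 / ((k : ℝ) + 1) := by positivity
                                        linarith
  have ht2 : ∀ k, t k ≤ 2 := fun k => by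
    have : 1 / ((k : ℝ) + 1) ≤ 1 := by
      rw [div_le_one (by positivity)]; have : (0 : ℝ) ≤ k := Nat.cast_nonneg k
      linarith
    simp only [t]; linarith
  have htlim : Tendsto t atTop (𝓝[≠] 1) := by
    refine tendsto_nhdsWithin_iff.2 ⟨?_, Eventually.of_forall fun k => (ht k).ne'⟩
    simpa [t] using tendsto_one_div_add_atTop_nhds_zero_nat.const_add (1 : ℝ)
  set G : ℕ → F → ℝ := fun k x =>
    (t k - 1)⁻¹ * (Real.exp (-W x) - Real.exp (-W (t k • x))) + C * Real.exp (-W x)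
  have hG0 : ∀ k x, 0 ≤ G k x := by
    intro k x
    have h1 : W x + (t k - 1) * (W x - W 0) ≤ W (t k • x) := by
      have htk : 0 < t k := one_pos.trans (ht k)
      have := hW.2 (mem_univ (t k • x)) (mem_univ 0) (inv_nonneg.2 htk.le)
        (sub_nonneg.2 (inv_le_one_of_one_le₀ (ht k).le)) (by ring)
      rw [smul_zero, add_zero, smul_smul, inv_mul_cancel₀ htk.ne', one_smul, smul_eq_mul,
        smul_eq_mul] at this
      have h2 := mul_le_mul_of_nonneg_left this htk.le
      have h3 : t k * ((t k)⁻¹ * W (t k • x) + (1 - (t k)⁻¹) * W 0) =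
        W (t k • x) + (t k - 1) * W 0 := by field_simp
      rw [h3] at h2
      linarith
    have h4 : Real.exp (-W (t k • x)) ≤ Real.exp (-W x) * Real.exp ((t k - 1) * M) := by
      rw [← Real.exp_add, Real.exp_le_exp]
      have : (t k - 1) * (-M) ≤ (t k - 1) * (W x - W 0) :=
        mul_le_mul_of_nonneg_left (by linarith [hWb x]) (by linarith [ht k])
      linarith
    have h5 : Real.exp ((t k - 1) * M) ≤ 1 + (t k - 1) * C := by
      have := convexOn_exp.2 (mem_univ M) (mem_univ 0) (sub_nonneg.2 (ht k).le)
        (by linarith [ht2 k] : 0 ≤ 1 - (t k - 1)) (by ring)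
      simp only [smul_eq_mul, mul_zero, add_zero, Real.exp_zero, mul_one] at this
      refine this.trans ?_
      simp only [C]
      linarith [ht k]
    have h6 : -((t k - 1) * (C * Real.exp (-W x))) ≤
        Real.exp (-W x) - Real.exp (-W (t k • x)) := by
      have := mul_le_mul_of_nonneg_left h5 (Real.exp_pos (-W x)).le
      linarith
    have h7 := mul_le_mul_of_nonneg_left h6 (inv_nonneg.2 (sub_nonneg.2 (ht k).le))
    have h8 : (t k - 1)⁻¹ * -((t k - 1) * (C * Real.exp (-W x))) = -(C * Real.exp (-W x)) := by
      rw [mul_neg, inv_mul_cancel_left₀ (sub_pos.2 (ht k)).ne']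
    simp only [G]
    linarith
  have hGi : ∀ k, Integrable (G k) μ := fun k =>
    ((hexp.sub (hexp.comp_smul (one_pos.trans (ht k)).ne')).const_mul _).add (hexp.const_mul _)
  have hGint : ∀ k, ∫ x, G k x ∂μ ≤ (d + C) * z := by
    intro k
    have htk : 0 < t k := one_pos.trans (ht k)
    have hcomp := hexp.comp_smul htk.ne'
    have hdiff : Integrable (fun x => Real.exp (-W x) - Real.exp (-W (t k • x))) μ :=
      hexp.sub hcomp
    have h1 : ∫ x, G k x ∂μ = (t k - 1)⁻¹ * (z - ((t k) ^ d)⁻¹ * z) + C * z := by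
      simp only [G]
      rw [integral_add (hdiff.const_mul _) (hexp.const_mul _), integral_const_mul,
        integral_const_mul, integral_sub hexp hcomp,
        Measure.integral_comp_smul μ (fun x => Real.exp (-W x)), abs_of_pos (by positivity),
        smul_eq_mul]
    have h2 : 1 - ((t k) ^ d)⁻¹ ≤ d * (t k - 1) := by
      have hb := one_add_mul_le_pow (a := (t k)⁻¹ - 1)
        (by have := inv_pos.2 htk; linarith) d
      rw [add_sub_cancel, inv_pow] at hb
      have h3 : 1 - (t k)⁻¹ ≤ t k - 1 := by
        have : (t k)⁻¹ * t k = 1 := inv_mul_cancel₀ htk.ne'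
        nlinarith [inv_le_one_of_one_le₀ (ht k).le, ht k]
      have := mul_le_mul_of_nonneg_left h3 (Nat.cast_nonneg (α := ℝ) d)
      linarith
    rw [h1, add_mul]
    refine add_le_add_left ?_ _
    rw [inv_mul_le_iff₀ (sub_pos.2 (ht k))]
    have := mul_le_mul_of_nonneg_right h2 hz0
    linarith
  have hlim : ∀ᵐ x ∂μ, Tendsto (fun k => G k x) atTop (𝓝 (φ x + C * Real.exp (-W x))) := by
    filter_upwards [hW.ae_differentiableAt (μ := μ)] with x hx
    have h1 : HasDerivAt (fun s : ℝ => W (s • x)) ⟪x, gradient W x⟫_ℝ 1 := by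
      have h2 : HasDerivAt (fun s : ℝ => s • x) x 1 := by
        simpa using (hasDerivAt_id (1 : ℝ)).smul_const x
      have h3 : HasFDerivAt W (fderiv ℝ W x) ((1 : ℝ) • x) := by simpa using hx.hasFDerivAt
      have := h3.comp_hasDerivAt (1 : ℝ) h2
      rwa [real_inner_comm, inner_gradient_left]
    have h4 := (h1.neg.exp.neg).tendsto_slope.comp htlim
    refine Tendsto.add ?_ tendsto_const_nhds
    convert h4 using 2
    · simp only [Function.comp, slope_def_field, Pi.neg_apply, one_smul]
      ring
    · simp only [φ, Pi.neg_apply, one_smul]; ring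
  have hfatou : ∫⁻ x, ENNReal.ofReal (φ x + C * Real.exp (-W x)) ∂μ ≤
      ENNReal.ofReal ((d + C) * z) := by
    calc ∫⁻ x, ENNReal.ofReal (φ x + C * Real.exp (-W x)) ∂μ
        = ∫⁻ x, liminf (fun k => ENNReal.ofReal (G k x)) atTop ∂μ := by
          refine lintegral_congr_ae ?_
          filter_upwards [hlim] with x hx
          exact ((ENNReal.continuous_ofReal.tendsto _).comp hx).liminf_eq.symm
      _ ≤ liminf (fun k => ∫⁻ x, ENNReal.ofReal (G k x) ∂μ) atTop :=
          lintegral_liminf_le fun k => by fun_prop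
      _ ≤ ENNReal.ofReal ((d + C) * z) := by
          refine liminf_le_of_le (by isBoundedDefault) fun c hc => ?_
          obtain ⟨k, hk⟩ := hc.exists
          refine hk.trans ?_
          rw [← ofReal_integral_eq_lintegral_ofReal (hGi k) (ae_of_all _ (hG0 k))]
          exact ENNReal.ofReal_le_ofReal (hGint k)
  have hsum : Integrable (fun x => φ x + C * Real.exp (-W x)) μ := by
    refine ⟨by fun_prop, ?_⟩
    rw [hasFiniteIntegral_iff_ofReal (ae_of_all _ hφ0)]
    exact hfatou.trans_lt ENNReal.ofReal_lt_top
  have hφi : Integrable φ μ :=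
    (hsum.sub (hexp.const_mul C)).congr (ae_of_all _ fun x => add_sub_cancel_right _ _)
  refine ⟨hφi, ?_⟩
  rw [← ofReal_integral_eq_lintegral_ofReal hsum (ae_of_all _ hφ0),
    ENNReal.ofReal_le_ofReal_iff (by positivity),
    integral_add hφi (hexp.const_mul C), integral_const_mul] at hfatou
  linarith

end Moment

section ProbOf

variable {n : ℕ} {W : EuclideanSpace ℝ (Fin n) → ℝ}

lemma integral_probOf (hWc : Continuous W) (hexp : Integrable (fun x => Real.exp (-W x)))
    (g : EuclideanSpace ℝ (Fin n) → ℝ) :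
    ∫ x, g x ∂(probOf W) = (∫ x, Real.exp (-W x))⁻¹ * ∫ x, g x * Real.exp (-W x) := by
  rw [probOf, integral_smul_measure, integral_withDensity_eq_integral_toReal_smul (by fun_prop)
    (ae_of_all _ fun x => ENNReal.ofReal_lt_top), smul_eq_mul,
    ← ofReal_integral_eq_lintegral_ofReal hexp (ae_of_all _ fun x => (Real.exp_pos _).le),
    ENNReal.toReal_inv, ENNReal.toReal_ofReal (integral_nonneg fun x => (Real.exp_pos _).le)]
  congr 2 with x
  rw [ENNReal.toReal_ofReal (Real.exp_pos _).le, smul_eq_mul, mul_comm]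

lemma inv_lintegral_exp_neg_ne_top (hexp : Integrable (fun x => Real.exp (-W x))) :
    (∫⁻ x, ENNReal.ofReal (Real.exp (-(W x))))⁻¹ ≠ ⊤ := by
  rw [← ofReal_integral_eq_lintegral_ofReal hexp (ae_of_all _ fun x => (Real.exp_pos _).le),
    ENNReal.inv_ne_top]
  exact (ENNReal.ofReal_pos.2 (integral_exp_pos hexp)).ne'

lemma integrable_probOf (hWc : Continuous W) (hexp : Integrable (fun x => Real.exp (-W x)))
    {g : EuclideanSpace ℝ (Fin n) → ℝ} (hg : Integrable (fun x => g x * Real.exp (-W x))) :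
    Integrable g (probOf W) := by
  refine Integrable.smul_measure ?_ (inv_lintegral_exp_neg_ne_top hexp)
  rw [integrable_withDensity_iff (by fun_prop) (ae_of_all _ fun x => ENNReal.ofReal_lt_top)]
  simpa only [ENNReal.toReal_ofReal (Real.exp_pos _).le] using hg

lemma probOf_absolutelyContinuous : probOf W ≪ volume :=
  (withDensity_absolutelyContinuous _ _).smul_left _

lemma relEnt_probOf (hWc : Continuous W) (hexp : Integrable (fun x => Real.exp (-W x)))
    (hexp' : Integrable (fun x => W x * Real.exp (-W x))) :
    relEnt (probOf W) = -(∫ x, W x ∂(probOf W)) - Real.log (∫ x, Real.exp (-W x)) := by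
  have hz := integral_exp_pos hexp
  have h1 : ∀ᵐ x ∂(probOf W), Real.log (((probOf W).rnDeriv volume x).toReal) =
      -W x - Real.log (∫ x, Real.exp (-W x)) := by
    refine probOf_absolutelyContinuous.ae_le ?_
    have h2 : probOf W = volume.withDensity (fun x =>
        (∫⁻ x, ENNReal.ofReal (Real.exp (-(W x))))⁻¹ * ENNReal.ofReal (Real.exp (-(W x)))) := by
      rw [probOf, ← withDensity_smul _ (by fun_prop)]
      rfl
    have h3 := Measure.rnDeriv_withDensity (volume : Measure (EuclideanSpace ℝ (Fin n)))
      (f := fun x => (∫⁻ x, ENNReal.ofReal (Real.exp (-(W x))))⁻¹ *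
        ENNReal.ofReal (Real.exp (-(W x)))) (by fun_prop)
    rw [← h2] at h3
    filter_upwards [h3] with x hx
    rw [hx, ← ofReal_integral_eq_lintegral_ofReal hexp (ae_of_all _ fun x => (Real.exp_pos _).le),
      ENNReal.toReal_mul, ENNReal.toReal_inv, ENNReal.toReal_ofReal hz.le,
      ENNReal.toReal_ofReal (Real.exp_pos _).le,
      Real.log_mul (inv_ne_zero hz.ne') (Real.exp_pos _).ne', Real.log_inv, Real.log_exp]
    ring
  have h4 : ∫ x, (1 : ℝ) ∂(probOf W) = 1 := by
    rw [integral_probOf hWc hexp]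
    simp only [one_mul]
    exact inv_mul_cancel₀ hz.ne'
  have hone : Integrable (fun _ => (1 : ℝ)) (probOf W) :=
    integrable_probOf hWc hexp (by simpa using hexp)
  have hneg : Integrable (fun x => -W x) (probOf W) := (integrable_probOf hWc hexp hexp').neg
  rw [relEnt, integral_congr_ae h1, integral_sub hneg
    (by simpa using hone.mul_const (Real.log (∫ x, Real.exp (-W x)))), integral_neg]
  congr 1
  have := integral_mul_const (μ := probOf W) (Real.log (∫ x, Real.exp (-W x))) (fun _ => (1 : ℝ))
  rw [h4] at this
  simpa using this

lemma eintegral_coe {α : Type*} [MeasurableSpace α] {ν : Measure α} {g : α → ℝ}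
    (hg : Integrable g ν) : eintegral ν (fun x => (g x : EReal)) = ((∫ x, g x ∂ν : ℝ) : EReal) := by
  have h1 : ∀ r : ℝ, ERealPos (r : EReal) = ENNReal.ofReal r := fun r => by simp [ERealPos]
  have h2 : ∀ r : ℝ, ERealPos (-(r : EReal)) = ENNReal.ofReal (-r) := fun r => by
    rw [← EReal.coe_neg, h1]
  have hp : ∫⁻ x, ENNReal.ofReal (g x) ∂ν ≠ ⊤ := hg.lintegral_lt_top.ne
  have hn : ∫⁻ x, ENNReal.ofReal (-g x) ∂ν ≠ ⊤ := hg.neg.lintegral_lt_top.ne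
  rw [integral_eq_lintegral_pos_part_sub_lintegral_neg_part hg, eintegral]
  simp only [h1, h2]
  rw [EReal.coe_sub, EReal.coe_ennreal_toReal hp, EReal.coe_ennreal_toReal hn]

lemma ConvexOn.eintegral_moment_measure_le {U : EuclideanSpace ℝ (Fin n) → ℝ}
    (hW : ConvexOn ℝ univ W) (hU : Continuous U) {a b b' : ℝ} (ha : 0 < a)
    (hgrow : ∀ x, a * ‖x‖ - b ≤ W x) (hUb : ∀ y, -b' ≤ U y)
    (hUW : ∀ x, DifferentiableAt ℝ W x → U (gradient W x) ≤ ⟪x, gradient W x⟫_ℝ - W x) :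
    eintegral (Measure.map (gradient W) (probOf W)) (fun y => ((U y : ℝ) : EReal)) ≤
      ((n + relEnt (probOf W) + Real.log (∫ x, Real.exp (-W x)) : ℝ) : EReal) := by
  have hWc : Continuous W := hW.locallyLipschitz.continuous
  have hexp := integrable_exp_neg_of_growth (μ := volume) hWc ha hgrow
  have hexp' := integrable_mul_exp_neg_of_growth (μ := volume) hWc ha hgrow
  obtain ⟨hφ, hφle⟩ := hW.integral_inner_gradient_mul_exp_neg_le (μ := volume) ha hgrow
  have hz := integral_exp_pos hexp
  have hgradm : Measurable (gradient W) :=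
    (InnerProductSpace.toDual ℝ _).symm.continuous.measurable.comp (measurable_fderiv ℝ W)
  have hdiff := (hφ.sub hexp').congr (ae_of_all _ fun x =>
    (sub_mul ⟪x, gradient W x⟫_ℝ (W x) (Real.exp (-W x))).symm)
  have hle : ∀ᵐ x, U (gradient W x) * Real.exp (-W x) ≤
      (⟪x, gradient W x⟫_ℝ - W x) * Real.exp (-W x) := by
    filter_upwards [hW.ae_differentiableAt (μ := volume)] with x hx
    exact mul_le_mul_of_nonneg_right (hUW x hx) (Real.exp_pos _).le
  have hUi : Integrable (fun x => U (gradient W x) * Real.exp (-W x)) := by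
    refine integrable_of_le_of_le (by fun_prop) (ae_of_all _ fun x => ?_) hle
      (hexp.const_mul (-b')) hdiff
    exact mul_le_mul_of_nonneg_right (hUb _) (Real.exp_pos _).le
  have hUi' : Integrable (fun x => U (gradient W x)) (probOf W) := integrable_probOf hWc hexp hUi
  have hmap : Integrable U (Measure.map (gradient W) (probOf W)) :=
    (integrable_map_measure hU.aestronglyMeasurable hgradm.aemeasurable).2 hUi'
  rw [eintegral_coe hmap, EReal.coe_le_coe_iff, integral_map hgradm.aemeasurable
    hU.aestronglyMeasurable, relEnt_probOf hWc hexp hexp', integral_probOf hWc hexp,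
    integral_probOf hWc hexp]
  have h1 := integral_mono_ae hUi hdiff hle
  simp only [sub_mul] at h1
  rw [integral_sub hφ hexp'] at h1
  rw [finrank_euclideanSpace_fin] at hφle
  have h2 := mul_le_mul_of_nonneg_left (h1.trans (sub_le_sub_right hφle _)) (inv_nonneg.2 hz.le)
  rw [mul_sub, mul_left_comm, inv_mul_cancel₀ hz.ne'] at h2
  linarith

/-- Biconjugation at points of differentiability of the conjugate. -/
lemma ConvexOn.le_inner_gradient_sub_conj {V Vs : EuclideanSpace ℝ (Fin n) → ℝ}
    (hV : ConvexOn ℝ univ V) (hVs : ∀ y, (Vs y : EReal) = fenchelR V y)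
    (hVsc : ConvexOn ℝ univ Vs) {y : EuclideanSpace ℝ (Fin n)} (hy : DifferentiableAt ℝ Vs y) :
    V (gradient Vs y) ≤ ⟪y, gradient Vs y⟫_ℝ - Vs y := by
  set x := gradient Vs y
  refine le_of_forall_lt fun t ht => ?_
  obtain ⟨t', htt', ht'⟩ := exists_between ht
  have hVc : Continuous V := hV.locallyLipschitz.continuous
  obtain ⟨l, c, hlc, hlx⟩ := ConvexOn.exists_affine_le_of_lt (𝕜 := ℝ) (mem_univ x) ht'
    isClosed_univ (hVc.lowerSemicontinuous.lowerSemicontinuousOn _) hV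
  have hlc' : ∀ z, l z + c ≤ V z := fun z => by simpa using hlc ⟨z, mem_univ z⟩
  simp only [RCLike.re_to_real] at hlx
  set p := (InnerProductSpace.toDual ℝ _).symm l
  have hp : ∀ z, l z = ⟪z, p⟫_ℝ := fun z => by
    rw [real_inner_comm]; exact (InnerProductSpace.toDual_symm_apply).symm
  have h1 : Vs p ≤ -c := by
    rw [← EReal.coe_le_coe_iff, hVs]
    refine iSup_le fun z => ?_
    rw [EReal.coe_le_coe_iff, ← hp]
    linarith [hlc' z]
  have h2 := hVsc.add_inner_gradient_le hy p
  rw [inner_sub_left, real_inner_comm, ← hp] at h2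
  change Vs y + (l x - _) ≤ _ at h2
  linarith

lemma convexOn_of_coe_eq_fenchelR {F : Type*} [NormedAddCommGroup F] [InnerProductSpace ℝ F]
    {V Vs : F → ℝ} (hVs : ∀ y, (Vs y : EReal) = fenchelR V y) : ConvexOn ℝ univ Vs := by
  have hyoung : ∀ x y, ⟪x, y⟫_ℝ - V x ≤ Vs y := fun x y => by
    rw [← EReal.coe_le_coe_iff, hVs]
    exact le_iSup (fun x => ((⟪x, y⟫_ℝ - V x : ℝ) : EReal)) x
  refine ⟨convex_univ, fun y _ z _ s t hs ht hst => ?_⟩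
  rw [← EReal.coe_le_coe_iff, hVs]
  refine iSup_le fun x => ?_
  rw [EReal.coe_le_coe_iff, inner_add_right, inner_smul_right, inner_smul_right, smul_eq_mul,
    smul_eq_mul]
  have h1 := mul_le_mul_of_nonneg_left (hyoung x y) hs
  have h2 := mul_le_mul_of_nonneg_left (hyoung x z) ht
  have h3 : V x = s * V x + t * V x := by rw [← add_mul, hst, one_mul]
  linarith

lemma pow_le_lintegral_mul_lintegral_of_growth {c : ℝ} (hc : 0 < c)
    (hyp : ∀ V Vs : EuclideanSpace ℝ (Fin n) → ℝ, ConvexOn ℝ Set.univ V →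
      (∀ y, (Vs y : EReal) = fenchelR V y) →
      ((relEnt (probOf V) + relEnt (probOf Vs) : ℝ) : EReal)
        ≤ ((-(n * Real.log (c * Real.exp 2)) : ℝ) : EReal)
          + eintegral (Measure.map (gradient V) (probOf V)) (fun y => ((Vs y : ℝ) : EReal))
          + eintegral (Measure.map (gradient Vs) (probOf Vs)) (fun x => ((V x : ℝ) : EReal)))
    {V Vs : EuclideanSpace ℝ (Fin n) → ℝ} (hV : ConvexOn ℝ univ V)
    (hVs : ∀ y, (Vs y : EReal) = fenchelR V y) {a b a' b' : ℝ} (ha : 0 < a) (ha' : 0 < a')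
    (hgrow : ∀ x, a * ‖x‖ - b ≤ V x) (hgrow' : ∀ y, a' * ‖y‖ - b' ≤ Vs y) :
    ENNReal.ofReal (c ^ n) ≤
      (∫⁻ x, ENNReal.ofReal (Real.exp (-V x))) * ∫⁻ y, ENNReal.ofReal (Real.exp (-Vs y)) := by
  have hVsc := convexOn_of_coe_eq_fenchelR hVs
  have hVc : Continuous V := hV.locallyLipschitz.continuous
  have hVsc' : Continuous Vs := hVsc.locallyLipschitz.continuous
  have hexp := integrable_exp_neg_of_growth (μ := volume) hVc ha hgrow
  have hexp' := integrable_exp_neg_of_growth (μ := volume) hVsc' ha' hgrow'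
  have hz := integral_exp_pos hexp
  have hz' := integral_exp_pos hexp'
  have h1 := hV.eintegral_moment_measure_le hVsc' ha hgrow (b' := b')
    (fun y => by have := hgrow' y; have : 0 ≤ a' * ‖y‖ := by positivity
                 linarith)
    (fun x hx => by
      rw [← EReal.coe_le_coe_iff, hVs]
      refine iSup_le fun z => ?_
      rw [EReal.coe_le_coe_iff]
      have := hV.add_inner_gradient_le hx z
      rw [inner_sub_left] at this
      linarith)
  have h2 := hVsc.eintegral_moment_measure_le hVc ha' hgrow' (b' := b)
    (fun y => by have := hgrow y; have : 0 ≤ a * ‖y‖ := by positivity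
                 linarith)
    (fun y hy => hV.le_inner_gradient_sub_conj hVs hVsc hy)
  have h3 := (hyp V Vs hV hVs).trans (add_le_add (add_le_add le_rfl h1) h2)
  rw [← EReal.coe_add, ← EReal.coe_add, EReal.coe_le_coe_iff,
    Real.log_mul hc.ne' (Real.exp_pos _).ne', Real.log_exp] at h3
  rw [← ofReal_integral_eq_lintegral_ofReal hexp (ae_of_all _ fun x => (Real.exp_pos _).le),
    ← ofReal_integral_eq_lintegral_ofReal hexp' (ae_of_all _ fun x => (Real.exp_pos _).le),
    ← ENNReal.ofReal_mul hz.le]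
  refine ENNReal.ofReal_le_ofReal ?_
  rw [← Real.log_le_log_iff (by positivity) (by positivity), Real.log_pow,
    Real.log_mul hz.ne' hz'.ne']
  linarith

end ProbOf

section Regularization

variable {F : Type*} [NormedAddCommGroup F] [InnerProductSpace ℝ F]

/-- The Moreau envelope of `f` with parameter `e`, plus the quadratic term `e / 2 * ‖x‖ ^ 2`. -/
def moreauReg (f : F → EReal) (e : ℝ) (x : F) : ℝ :=
  (⨅ z : {z // f z ≠ ⊤}, ((f z).toReal + ‖x - z‖ ^ 2 / (2 * e))) + e / 2 * ‖x‖ ^ 2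

variable {f : F → EReal} {a b e : ℝ}

omit [InnerProductSpace ℝ F] in
lemma le_toReal_of_growth (hgrow : ∀ x, ((a * ‖x‖ - b : ℝ) : EReal) ≤ f x) {z : F}
    (hz : f z ≠ ⊤) : a * ‖z‖ - b ≤ (f z).toReal := by
  have := EReal.toReal_le_toReal (hgrow z) (EReal.coe_ne_bot _) hz
  rwa [EReal.toReal_coe] at this

omit [InnerProductSpace ℝ F] in
lemma moreauReg_le (ha : 0 ≤ a) (hgrow : ∀ x, ((a * ‖x‖ - b : ℝ) : EReal) ≤ f x) (he : 0 < e)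
    {z : F} (hz : f z ≠ ⊤) (x : F) :
    moreauReg f e x ≤ (f z).toReal + ‖x - z‖ ^ 2 / (2 * e) + e / 2 * ‖x‖ ^ 2 := by
  refine add_le_add_left (ciInf_le (f := fun z : {z // f z ≠ ⊤} =>
    (f z).toReal + ‖x - z‖ ^ 2 / (2 * e)) ⟨-b, ?_⟩ ⟨z, hz⟩) _
  rintro _ ⟨w, rfl⟩
  have h1 := le_toReal_of_growth hgrow w.2
  have h2 : 0 ≤ a * ‖(w : F)‖ := by positivity
  have h3 : 0 ≤ ‖x - w‖ ^ 2 / (2 * e) := by positivity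
  change -b ≤ (f w).toReal + ‖x - w‖ ^ 2 / (2 * e)
  linarith

omit [InnerProductSpace ℝ F] in
lemma le_moreauReg (hproper : ∃ x, f x ≠ ⊤) {x : F} {t : ℝ}
    (h : ∀ z, f z ≠ ⊤ → t ≤ (f z).toReal + ‖x - z‖ ^ 2 / (2 * e)) :
    t + e / 2 * ‖x‖ ^ 2 ≤ moreauReg f e x := by
  obtain ⟨x₀, hx₀⟩ := hproper
  have : Nonempty {z // f z ≠ ⊤} := ⟨⟨x₀, hx₀⟩⟩
  exact add_le_add_left (le_ciInf (f := fun z : {z // f z ≠ ⊤} =>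
    (f z).toReal + ‖x - z‖ ^ 2 / (2 * e)) fun z => h z z.2) _

omit [InnerProductSpace ℝ F] in
lemma growth_le_moreauReg (hproper : ∃ x, f x ≠ ⊤) (ha : 0 ≤ a)
    (hgrow : ∀ x, ((a * ‖x‖ - b : ℝ) : EReal) ≤ f x) (he : 0 < e) (he1 : e ≤ 1) (x : F) :
    a * ‖x‖ - (b + a ^ 2 / 2) + e / 2 * ‖x‖ ^ 2 ≤ moreauReg f e x := by
  refine le_moreauReg hproper fun z hz => ?_
  have h1 := le_toReal_of_growth hgrow hz
  have h2 : ‖x‖ ≤ ‖z‖ + ‖x - z‖ := by simpa using norm_add_le z (x - z)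
  have h3 := mul_le_mul_of_nonneg_left h2 ha
  have h4 : ‖x - z‖ ^ 2 / 2 ≤ ‖x - z‖ ^ 2 / (2 * e) := by gcongr; linarith
  nlinarith [sq_nonneg (‖x - z‖ - a)]

lemma norm_sq_convex_comb_le {s t : ℝ} (hs : 0 ≤ s) (ht : 0 ≤ t) (hst : s + t = 1) (x y : F) :
    ‖s • x + t • y‖ ^ 2 ≤ s * ‖x‖ ^ 2 + t * ‖y‖ ^ 2 :=
  (convexOn_univ_norm.pow (fun _ _ => norm_nonneg _) 2).2 (mem_univ x) (mem_univ y) hs ht hst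

lemma convexOn_moreauReg (hconv : ConvexEReal f) (hbot : ∀ x, f x ≠ ⊥)
    (hproper : ∃ x, f x ≠ ⊤) (ha : 0 ≤ a)
    (hgrow : ∀ x, ((a * ‖x‖ - b : ℝ) : EReal) ≤ f x) (he : 0 < e) :
    ConvexOn ℝ univ (moreauReg f e) := by
  refine ⟨convex_univ, fun x _ y _ s t hs ht hst => ?_⟩
  obtain ⟨x₀, hx₀⟩ := hproper
  have : Nonempty {z // f z ≠ ⊤} := ⟨⟨x₀, hx₀⟩⟩
  refine le_of_forall_pos_le_add fun δ hδ => ?_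
  obtain ⟨z, hz⟩ := exists_lt_of_ciInf_lt (lt_add_of_pos_right
    (⨅ z : {z // f z ≠ ⊤}, ((f z).toReal + ‖x - z‖ ^ 2 / (2 * e))) hδ)
  obtain ⟨w, hw⟩ := exists_lt_of_ciInf_lt (lt_add_of_pos_right
    (⨅ z : {z // f z ≠ ⊤}, ((f z).toReal + ‖y - z‖ ^ 2 / (2 * e))) hδ)
  have hzw := hconv.convexOn_toReal hbot
  have h1 := moreauReg_le ha hgrow he (hzw.1 z.2 w.2 hs ht hst) (s • x + t • y)
  have h2 := hzw.2 z.2 w.2 hs ht hst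
  have h3 := norm_sq_convex_comb_le hs ht hst x y
  have h4 := norm_sq_convex_comb_le hs ht hst (x - z) (y - w)
  have h5 : s • x + t • y - (s • (z : F) + t • (w : F)) = s • (x - z) + t • (y - w) := by
    rw [smul_sub, smul_sub]; abel
  rw [h5] at h1
  simp only [smul_eq_mul] at h2 ⊢
  have h6 := mul_le_mul_of_nonneg_left h3 (by positivity : 0 ≤ e / 2)
  have h7 := div_le_div_of_nonneg_right h4 (by positivity : 0 ≤ 2 * e)
  have h8 := mul_le_mul_of_nonneg_left hz.le hs
  have h9 := mul_le_mul_of_nonneg_left hw.le ht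
  have h10 : δ = s * δ + t * δ := by rw [← add_mul, hst, one_mul]
  rw [add_div, mul_div_assoc, mul_div_assoc] at h7
  unfold moreauReg at h1 ⊢
  linarith

omit [InnerProductSpace ℝ F] in
lemma exists_le_moreauReg (hproper : ∃ x, f x ≠ ⊤) (hlsc : LowerSemicontinuous f) (ha : 0 ≤ a)
    (hgrow : ∀ x, ((a * ‖x‖ - b : ℝ) : EReal) ≤ f x) {x : F} {t : ℝ} (ht : (t : EReal) < f x) :
    ∃ e₀ > 0, ∀ e, 0 < e → e ≤ e₀ → t ≤ moreauReg f e x := by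
  obtain ⟨δ, hδ, hball⟩ := Metric.eventually_nhds_iff.1 (hlsc x t ht)
  refine ⟨δ ^ 2 / (2 * (|t| + |b| + 1)), by positivity, fun e he hle => ?_⟩
  have h0 : 0 ≤ e / 2 * ‖x‖ ^ 2 := by positivity
  refine (le_add_of_nonneg_right h0).trans (le_moreauReg hproper fun z hz => ?_)
  have h1 : 0 ≤ ‖x - z‖ ^ 2 / (2 * e) := by positivity
  by_cases hxz : dist z x < δ
  · have h2 := EReal.toReal_le_toReal (hball hxz).le (EReal.coe_ne_bot _) hz
    rw [EReal.toReal_coe] at h2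
    linarith
  · have h2 := le_toReal_of_growth hgrow hz
    have h3 : 0 ≤ a * ‖z‖ := by positivity
    rw [dist_comm, dist_eq_norm, not_lt] at hxz
    have h4 : |t| + |b| + 1 ≤ ‖x - z‖ ^ 2 / (2 * e) := by
      rw [le_div_iff₀ (by positivity)]
      rw [le_div_iff₀ (by positivity)] at hle
      have : δ ^ 2 ≤ ‖x - z‖ ^ 2 := by gcongr
      linarith
    linarith [le_abs_self t, le_abs_self b]

variable (f) in
/-- The Legendre transform of `moreauReg f e`, as a real-valued function. -/
def moreauRegConj (e : ℝ) (y : F) : ℝ := (fenchelR (moreauReg f e) y).toReal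

lemma coe_moreauRegConj (hproper : ∃ x, f x ≠ ⊤) (ha : 0 ≤ a)
    (hgrow : ∀ x, ((a * ‖x‖ - b : ℝ) : EReal) ≤ f x) (he : 0 < e) (he1 : e ≤ 1) (y : F) :
    (moreauRegConj f e y : EReal) = fenchelR (moreauReg f e) y := by
  refine EReal.coe_toReal ?_ ?_
  · refine ne_top_of_le_ne_top (EReal.coe_ne_top (b + a ^ 2 / 2 + ‖y‖ ^ 2 / (2 * e)))
      (iSup_le fun x => EReal.coe_le_coe_iff.2 ?_)
    have h1 := growth_le_moreauReg hproper ha hgrow he he1 x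
    have h2 := real_inner_le_norm x y
    have h3 : 0 ≤ a * ‖x‖ := by positivity
    have h4 : ‖x‖ * ‖y‖ ≤ e / 2 * ‖x‖ ^ 2 + ‖y‖ ^ 2 / (2 * e) := by
      have h5 : e / 2 * ‖x‖ ^ 2 + ‖y‖ ^ 2 / (2 * e) - ‖x‖ * ‖y‖ =
        (e * ‖x‖ - ‖y‖) ^ 2 / (2 * e) := by field_simp; ring
      have : 0 ≤ (e * ‖x‖ - ‖y‖) ^ 2 / (2 * e) := by positivity
      linarith
    linarith
  · exact ne_bot_of_le_ne_bot (EReal.coe_ne_bot _)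
      (le_iSup (fun x => ((⟪x, y⟫_ℝ - moreauReg f e x : ℝ) : EReal)) 0)

lemma le_moreauRegConj (hproper : ∃ x, f x ≠ ⊤) (ha : 0 ≤ a)
    (hgrow : ∀ x, ((a * ‖x‖ - b : ℝ) : EReal) ≤ f x) (he : 0 < e) (he1 : e ≤ 1) {x : F}
    (hx : f x ≠ ⊤) (y : F) :
    ⟪x, y⟫_ℝ - (f x).toReal - e / 2 * ‖x‖ ^ 2 ≤ moreauRegConj f e y := by
  rw [← EReal.coe_le_coe_iff, coe_moreauRegConj hproper ha hgrow he he1]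
  refine le_trans ?_ (le_iSup (fun x => ((⟪x, y⟫_ℝ - moreauReg f e x : ℝ) : EReal)) x)
  rw [EReal.coe_le_coe_iff]
  have := moreauReg_le ha hgrow he hx x
  rw [sub_self, norm_zero, zero_pow two_ne_zero, zero_div, add_zero] at this
  linarith

lemma growth_le_moreauRegConj (hproper : ∃ x, f x ≠ ⊤) (hbot : ∀ x, f x ≠ ⊥) (ha : 0 ≤ a)
    (hgrow : ∀ x, ((a * ‖x‖ - b : ℝ) : EReal) ≤ f x) (he : 0 < e) (he1 : e ≤ 1) {r M : ℝ}
    (hr : 0 < r) (hM : ∀ x, ‖x‖ ≤ r → f x ≤ M) (y : F) :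
    r * ‖y‖ - (M + r ^ 2 / 2) ≤ moreauRegConj f e y := by
  set x : F := (r / ‖y‖) • y
  have hx : ‖x‖ ≤ r := by
    simp only [x, norm_smul, norm_div, norm_norm, Real.norm_of_nonneg hr.le]
    rcases eq_or_ne ‖y‖ 0 with h | h
    · simpa [h] using hr.le
    · rw [div_mul_cancel₀ _ h]
  have hxy : ⟪x, y⟫_ℝ = r * ‖y‖ := by
    simp only [x, inner_smul_left, real_inner_self_eq_norm_sq, conj_trivial]
    rcases eq_or_ne ‖y‖ 0 with h | h
    · simp [h]
    · field_simp
  have hfx : f x ≠ ⊤ := ne_top_of_le_ne_top (EReal.coe_ne_top _) (hM x hx)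
  have h1 := EReal.toReal_le_toReal (hM x hx) (hbot x) (EReal.coe_ne_top _)
  rw [EReal.toReal_coe] at h1
  have h2 := le_moreauRegConj hproper ha hgrow he he1 hfx y
  have h3 : ‖x‖ ^ 2 ≤ r ^ 2 := by gcongr
  have h4 : e / 2 * ‖x‖ ^ 2 ≤ 1 / 2 * r ^ 2 := by gcongr
  rw [hxy] at h2
  linarith

lemma exists_le_moreauRegConj (hproper : ∃ x, f x ≠ ⊤) (hbot : ∀ x, f x ≠ ⊥) (ha : 0 ≤ a)
    (hgrow : ∀ x, ((a * ‖x‖ - b : ℝ) : EReal) ≤ f x) {y : F} {t : ℝ}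
    (ht : (t : EReal) < fenchel f y) :
    ∃ e₀ > 0, ∀ e, 0 < e → e ≤ e₀ → e ≤ 1 → t ≤ moreauRegConj f e y := by
  obtain ⟨x, hx⟩ := lt_iSup_iff.1 ht
  have hfx : f x ≠ ⊤ := by
    intro h
    rw [h, EReal.sub_top] at hx
    exact not_lt_bot hx
  rw [← EReal.coe_toReal hfx (hbot x), ← EReal.coe_sub, EReal.coe_lt_coe_iff] at hx
  have hg : 0 < ⟪x, y⟫_ℝ - (f x).toReal - t := by linarith
  refine ⟨(⟪x, y⟫_ℝ - (f x).toReal - t) / (‖x‖ ^ 2 + 1), by positivity, fun e he hle he1 => ?_⟩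
  have h1 := le_moreauRegConj hproper ha hgrow he he1 hfx y
  rw [le_div_iff₀ (by positivity)] at hle
  have : 0 ≤ e * ‖x‖ ^ 2 := by positivity
  linarith

lemma limsup_exp_neg_le {v : ℕ → ℝ} {s : EReal} (hs : s ≠ ⊥)
    (h : ∀ t : ℝ, (t : EReal) < s → ∀ᶠ k in atTop, t ≤ v k) :
    limsup (fun k => ENNReal.ofReal (Real.exp (-v k))) atTop ≤ ENNReal.ofReal (expNeg s) := by
  have h1 : ∀ t : ℝ, (t : EReal) < s →
      limsup (fun k => ENNReal.ofReal (Real.exp (-v k))) atTop ≤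
        ENNReal.ofReal (Real.exp (-t)) := fun t ht =>
    limsup_le_of_le (by isBoundedDefault) <| (h t ht).mono fun k hk =>
      ENNReal.ofReal_le_ofReal (Real.exp_le_exp.2 (neg_le_neg hk))
  induction s with
  | bot => exact absurd rfl hs
  | top =>
    refine ge_of_tendsto (f := fun t : ℝ => ENNReal.ofReal (Real.exp (-t))) (x := atTop) ?_
      (Eventually.of_forall fun t => h1 t (EReal.coe_lt_top t))
    have := (ENNReal.continuous_ofReal.tendsto 0).comp
      (Real.tendsto_exp_atBot.comp tendsto_neg_atTop_atBot)
    simpa [expNeg, Function.comp_def] using this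
  | coe s =>
    refine ge_of_tendsto (f := fun t : ℝ => ENNReal.ofReal (Real.exp (-t))) (x := 𝓝[<] s) ?_
      (eventually_nhdsWithin_of_forall fun t ht => h1 t (EReal.coe_lt_coe_iff.2 ht))
    have hc : Continuous fun t : ℝ => ENNReal.ofReal (Real.exp (-t)) :=
      ENNReal.continuous_ofReal.comp (by fun_prop)
    simpa [expNeg] using (hc.tendsto s).mono_left nhdsWithin_le_nhds

variable [FiniteDimensional ℝ F] [MeasurableSpace F] [BorelSpace F]
  {μ : Measure F} [μ.IsAddHaarMeasure]

lemma limsup_lintegral_exp_neg_le {V : ℕ → F → ℝ} {g : F → EReal} (hV : ∀ k, Continuous (V k))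
    (hg : ∀ x, g x ≠ ⊥) (ha : 0 < a) (hgrow : ∀ k x, a * ‖x‖ - b ≤ V k x)
    (h : ∀ x, ∀ t : ℝ, (t : EReal) < g x → ∀ᶠ k in atTop, t ≤ V k x) :
    limsup (fun k => ∫⁻ x, ENNReal.ofReal (Real.exp (-V k x)) ∂μ) atTop ≤
      ∫⁻ x, ENNReal.ofReal (expNeg (g x)) ∂μ := by
  refine (limsup_lintegral_le (fun x => ENNReal.ofReal (Real.exp (-(a * ‖x‖ - b))))
    (fun k => by have := hV k; fun_prop) (fun k => ae_of_all _ fun x => ?_) ?_).trans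
    (lintegral_mono fun x => limsup_exp_neg_le (hg x) (h x))
  · exact ENNReal.ofReal_le_ofReal (Real.exp_le_exp.2 (neg_le_neg (hgrow k x)))
  · exact (integrable_exp_neg_of_growth (by fun_prop) ha fun x => le_rfl).lintegral_lt_top.ne

end Regularization

/-- Theorem 2.6, (iv) ⟹ (i). Fix `c > 0` and `n ≥ 1`.
If for every convex `V : ℝⁿ → ℝ` with everywhere finite Fenchel-Legendre transform `V*`
one has `H(η) + H(η*) ≤ -n log(c e²) + ∫ V* dν + ∫ V dν*` (with `η, η*` proportional to
`e^{-V}, e^{-V*}` and `ν, ν*` their moment measures), then for every proper convex lsc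
`f : ℝⁿ → ℝ ∪ {+∞}` with `∫ e^{-f} dx > 0` and `∫ e^{-f*} dx > 0` one has
`∫ e^{-f} dx ∫ e^{-f*} dx ≥ cⁿ`. -/
theorem statement4 {n : ℕ} (hn : 1 ≤ n) (c : ℝ) (hc : 0 < c)
    (hyp : ∀ V Vs : EuclideanSpace ℝ (Fin n) → ℝ, ConvexOn ℝ Set.univ V →
      (∀ y, (Vs y : EReal) = fenchelR V y) →
      ((relEnt (probOf V) + relEnt (probOf Vs) : ℝ) : EReal)
        ≤ ((-(n * Real.log (c * Real.exp 2)) : ℝ) : EReal)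
          + eintegral (Measure.map (gradient V) (probOf V)) (fun y => ((Vs y : ℝ) : EReal))
          + eintegral (Measure.map (gradient Vs) (probOf Vs)) (fun x => ((V x : ℝ) : EReal))) :
    ∀ f : EuclideanSpace ℝ (Fin n) → EReal, IsProperConvexLSC f →
      0 < ∫⁻ x, ENNReal.ofReal (expNeg (f x)) →
      0 < ∫⁻ y, ENNReal.ofReal (expNeg (fenchel f y)) →
      ENNReal.ofReal (c ^ n)
        ≤ (∫⁻ x, ENNReal.ofReal (expNeg (f x))) * ∫⁻ y, ENNReal.ofReal (expNeg (fenchel f y)) := by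
  intro f hf hpos hpos'
  by_cases hfin : ∫⁻ x, ENNReal.ofReal (expNeg (f x)) = ⊤
  · rw [hfin, ENNReal.top_mul hpos'.ne']; exact le_top
  by_cases hfin' : ∫⁻ y, ENNReal.ofReal (expNeg (fenchel f y)) = ⊤
  · rw [hfin', ENNReal.mul_top hpos.ne']; exact le_top
  have h0 := zero_mem_interior_of_lintegral_fenchel hf hpos hpos' hfin'
  obtain ⟨a, b, ha, hgrow⟩ := hf.exists_linear_growth h0 hfin
  obtain ⟨hconv, hlsc, hbot, hproper⟩ := hf
  obtain ⟨r, M, hr, hM⟩ := hconv.exists_le_on_ball hbot h0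
  set e : ℕ → ℝ := fun k => 1 / ((k : ℝ) + 1)
  have he : ∀ k, 0 < e k := fun k => by simp only [e]; positivity
  have he1 : ∀ k, e k ≤ 1 := fun k => by
    simp only [e]
    rw [div_le_one (by positivity)]
    linarith [Nat.cast_nonneg (α := ℝ) k]
  have hesmall : ∀ e₀ > 0, ∀ᶠ k in atTop, e k ≤ e₀ := fun e₀ h =>
    (tendsto_one_div_add_atTop_nhds_zero_nat.eventually_lt_const h).mono fun _ => le_of_lt
  have hV := fun k => convexOn_moreauReg hconv hbot hproper ha.le hgrow (he k)
  have hVs := fun k => coe_moreauRegConj hproper ha.le hgrow (he k) (he1 k)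
  have hVg : ∀ k x, a * ‖x‖ - (b + a ^ 2 / 2) ≤ moreauReg f (e k) x := fun k x => by
    have h1 := growth_le_moreauReg hproper ha.le hgrow (he k) (he1 k) x
    have h2 : 0 ≤ e k / 2 * ‖x‖ ^ 2 := by have := he k; positivity
    linarith
  have hVsg := fun k => growth_le_moreauRegConj hproper hbot ha.le hgrow (he k) (he1 k) hr hM
  have hprod := fun k => pow_le_lintegral_mul_lintegral_of_growth hc hyp (hV k) (hVs k) ha hr
    (hVg k) (hVsg k)
  have hl1 := limsup_lintegral_exp_neg_le (μ := volume)
    (fun k => (hV k).locallyLipschitz.continuous) hbot ha hVg fun x t ht => by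
      obtain ⟨e₀, he₀, h⟩ := exists_le_moreauReg hproper hlsc ha.le hgrow ht
      exact (hesmall e₀ he₀).mono fun k hk => h _ (he k) hk
  have hl2 := limsup_lintegral_exp_neg_le (μ := volume)
    (fun k => (convexOn_of_coe_eq_fenchelR (hVs k)).locallyLipschitz.continuous)
    (fenchel_ne_bot hbot hproper) hr hVsg fun y t ht => by
      obtain ⟨e₀, he₀, h⟩ := exists_le_moreauRegConj hproper hbot ha.le hgrow ht
      exact (hesmall e₀ he₀).mono fun k hk => h _ (he k) hk (he1 k)
  refine le_trans ?_ (mul_le_mul' hl1 hl2)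
  refine le_trans ?_ (ENNReal.limsup_mul_le' (Or.inr (ne_top_of_le_ne_top hfin' hl2))
    (Or.inl (ne_top_of_le_ne_top hfin hl1)))
  exact le_limsup_of_frequently_le (Frequently.of_forall hprod) (by isBoundedDefault)

end
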